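/- Let S = {s_1, …, s_m} be a finite family of splits satisfying the tree (laminar) condition, and define the fitted values ŷ_i = ȳ + Σ_{j=1}^{m} β_j ψ(i; s_j), where ȳ = n⁻¹ Σ_{i=1}^{n} y_i and β_j = (Σ_{i=1}^{n} y_i ψ(i; s_j)) / |v_j|. Then ŷ is the ordinary least squares fit of y on the intercept together with the stump features: for every choice of coefficients c_0 ∈ ℝ and c_1, …, c_m ∈ ℝ, Σ_{i=1}^{n} (y_i − ŷ_i)² ≤ Σ_{i=1}^{n} (y_i − c_0 − Σ_{j=1}^{m} c_j ψ(i; s_j))². -/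

import Mathlib

open Finset

variable {n : ℕ}

/-- Mean response of the training samples in node `v`. -/
noncomputable def nodeMean (y : Fin n → ℝ) (v : Finset (Fin n)) : ℝ :=
  ((v.card : ℝ))⁻¹ * ∑ i ∈ v, y i

/-- Stump function of the split of a node into children `vL`, `vR`. -/
noncomputable def stump (vL vR : Finset (Fin n)) (i : Fin n) : ℝ :=
  ((vR.card : ℝ) * (if i ∈ vL then (1 : ℝ) else 0)
      - (vL.card : ℝ) * (if i ∈ vR then (1 : ℝ) else 0))
    / Real.sqrt ((vL.card : ℝ) * (vR.card : ℝ))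

/-- Impurity decrease of the split of node `vL ∪ vR` into children `vL`, `vR`. -/
noncomputable def impurityDecrease (y : Fin n → ℝ) (vL vR : Finset (Fin n)) : ℝ :=
  (((vL ∪ vR).card : ℝ))⁻¹ *
    ((∑ i ∈ vL ∪ vR, (y i - nodeMean y (vL ∪ vR)) ^ 2)
      - (∑ i ∈ vL, (y i - nodeMean y vL) ^ 2)
      - (∑ i ∈ vR, (y i - nodeMean y vR) ^ 2))

/-- The fit whose coefficients on a pairwise orthogonal family are the individual projection
coefficients minimises the residual sum of squares. -/
theorem sum_sq_sub_orthogonal_fit_le {α ι : Type*} [Fintype α] [Fintype ι]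
    (φ : ι → α → ℝ) (hφ : ∀ j k, j ≠ k → ∑ i, φ j i * φ k i = 0) (y : α → ℝ) (c : ι → ℝ) :
    ∑ i, (y i - ∑ j, (∑ a, y a * φ j a) / (∑ a, φ j a ^ 2) * φ j i) ^ 2
      ≤ ∑ i, (y i - ∑ j, c j * φ j i) ^ 2 := by
  set β : ι → ℝ := fun j => (∑ a, y a * φ j a) / (∑ a, φ j a ^ 2) with hβ
  set r : α → ℝ := fun i => y i - ∑ j, β j * φ j i with hr
  have hβ_mul (k : ι) : β k * ∑ i, φ k i ^ 2 = ∑ i, y i * φ k i := by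
    refine div_mul_cancel_of_imp fun h => ?_
    rw [Finset.sum_eq_zero_iff_of_nonneg fun i _ => sq_nonneg _] at h
    exact Finset.sum_eq_zero fun i hi => by rw [pow_eq_zero_iff two_ne_zero |>.1 (h i hi), mul_zero]
  have hr_orth (k : ι) : ∑ i, r i * φ k i = 0 := by
    have hfit : ∑ i, (∑ j, β j * φ j i) * φ k i = β k * ∑ i, φ k i ^ 2 := by
      simp_rw [Finset.sum_mul, mul_assoc]
      rw [Finset.sum_comm]
      simp_rw [← Finset.mul_sum]
      rw [Finset.sum_eq_single k (fun j _ hj => by rw [hφ j k hj, mul_zero]) (by simp)]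
      simp_rw [sq]
    simp_rw [hr, sub_mul]
    rw [Finset.sum_sub_distrib, hfit, hβ_mul, sub_self]
  set d : α → ℝ := fun i => ∑ j, (β j - c j) * φ j i with hd
  have hrd : ∑ i, r i * d i = 0 := by
    simp_rw [hd, Finset.mul_sum, mul_left_comm (r _)]
    rw [Finset.sum_comm]
    simp_rw [← Finset.mul_sum, hr_orth, mul_zero, Finset.sum_const_zero]
  have hdecomp (i : α) : y i - ∑ j, c j * φ j i = r i + d i := by
    simp only [hr, hd, sub_mul, Finset.sum_sub_distrib]
    ring
  have hexpand : ∑ i, (r i + d i) ^ 2 = ∑ i, r i ^ 2 + 2 * ∑ i, r i * d i + ∑ i, d i ^ 2 := by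
    rw [Finset.mul_sum, ← Finset.sum_add_distrib, ← Finset.sum_add_distrib]
    exact Finset.sum_congr rfl fun i _ => by ring
  simp_rw [hdecomp]
  rw [hexpand, hrd]
  linarith [Finset.sum_nonneg fun i (_ : i ∈ univ) => sq_nonneg (d i)]

theorem sum_mul_stump (f : Fin n → ℝ) (vL vR : Finset (Fin n)) :
    ∑ i, f i * stump vL vR i
      = ((vR.card : ℝ) * ∑ i ∈ vL, f i - (vL.card : ℝ) * ∑ i ∈ vR, f i)
        / Real.sqrt ((vL.card : ℝ) * (vR.card : ℝ)) := by
  simp_rw [stump, mul_div_assoc', ← Finset.sum_div, mul_sub, Finset.sum_sub_distrib,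
    mul_left_comm (f _), ← Finset.mul_sum]
  simp

/-- A stump function is orthogonal to every function that is constant on its node. -/
theorem sum_mul_stump_eq_zero {f : Fin n → ℝ} {vL vR : Finset (Fin n)} (a : ℝ)
    (hf : ∀ i ∈ vL ∪ vR, f i = a) : ∑ i, f i * stump vL vR i = 0 := by
  rw [sum_mul_stump, Finset.sum_congr rfl fun i hi => hf i (mem_union_left _ hi),
    Finset.sum_congr rfl fun i hi => hf i (mem_union_right _ hi)]
  simp only [Finset.sum_const, nsmul_eq_mul]
  rw [div_eq_zero_iff]
  left
  ring

theorem stump_of_mem_left {vL vR : Finset (Fin n)} (hd : Disjoint vL vR) {i : Fin n}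
    (hi : i ∈ vL) : stump vL vR i = vR.card / Real.sqrt ((vL.card : ℝ) * (vR.card : ℝ)) := by
  simp [stump, hi, Finset.disjoint_left.1 hd hi]

theorem stump_of_mem_right {vL vR : Finset (Fin n)} (hd : Disjoint vL vR) {i : Fin n}
    (hi : i ∈ vR) : stump vL vR i = -vL.card / Real.sqrt ((vL.card : ℝ) * (vR.card : ℝ)) := by
  simp [stump, hi, Finset.disjoint_right.1 hd hi]

theorem stump_of_notMem {vL vR : Finset (Fin n)} {i : Fin n} (hi : i ∉ vL ∪ vR) :
    stump vL vR i = 0 := by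
  rw [mem_union, not_or] at hi
  simp [stump, hi.1, hi.2]

theorem sum_stump_sq {vL vR : Finset (Fin n)} (hL : vL.Nonempty) (hR : vR.Nonempty)
    (hd : Disjoint vL vR) : ∑ i, stump vL vR i ^ 2 = ((vL ∪ vR).card : ℝ) := by
  have hl : (0 : ℝ) < vL.card := by exact_mod_cast hL.card_pos
  have hr : (0 : ℝ) < vR.card := by exact_mod_cast hR.card_pos
  simp_rw [sq]
  rw [sum_mul_stump, Finset.sum_congr rfl fun i hi => stump_of_mem_left hd hi,
    Finset.sum_congr rfl fun i hi => stump_of_mem_right hd hi, card_union_of_disjoint hd]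
  have hs := Real.mul_self_sqrt (mul_pos hl hr).le
  have hs0 := Real.sqrt_pos.2 (mul_pos hl hr)
  set q := Real.sqrt ((vL.card : ℝ) * (vR.card : ℝ))
  simp only [Finset.sum_const, nsmul_eq_mul, Nat.cast_add]
  field_simp
  rw [sq, hs]
  ring

/-- Stump functions of laminar splits are orthogonal. -/
theorem sum_stump_mul_stump_eq_zero {vL vR wL wR : Finset (Fin n)}
    (hv : Disjoint vL vR) (hw : Disjoint wL wR)
    (h : Disjoint (vL ∪ vR) (wL ∪ wR) ∨ (vL ∪ vR) ⊆ wL ∨ (vL ∪ vR) ⊆ wR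
      ∨ (wL ∪ wR) ⊆ vL ∨ (wL ∪ wR) ⊆ vR) :
    ∑ i, stump vL vR i * stump wL wR i = 0 := by
  rcases h with h | h | h | h | h
  · exact sum_mul_stump_eq_zero 0 fun i hi => stump_of_notMem (Finset.disjoint_right.1 h hi)
  · simp_rw [mul_comm (stump vL vR _)]
    exact sum_mul_stump_eq_zero _ fun i hi => stump_of_mem_left hw (h hi)
  · simp_rw [mul_comm (stump vL vR _)]
    exact sum_mul_stump_eq_zero _ fun i hi => stump_of_mem_right hw (h hi)
  · exact sum_mul_stump_eq_zero _ fun i hi => stump_of_mem_left hv (h hi)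
  · exact sum_mul_stump_eq_zero _ fun i hi => stump_of_mem_right hv (h hi)

theorem stump_fit_is_ols {m : ℕ} (y : Fin n → ℝ) (vL vR : Fin m → Finset (Fin n))
    (hL : ∀ j, (vL j).Nonempty) (hR : ∀ j, (vR j).Nonempty)
    (hd : ∀ j, Disjoint (vL j) (vR j))
    (laminar : ∀ j j', j ≠ j' →
      Disjoint (vL j ∪ vR j) (vL j' ∪ vR j')
      ∨ (vL j ∪ vR j) ⊆ vL j' ∨ (vL j ∪ vR j) ⊆ vR j'
      ∨ (vL j' ∪ vR j') ⊆ vL j ∨ (vL j' ∪ vR j') ⊆ vR j) :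
    let ybar := (n : ℝ)⁻¹ * ∑ i, y i
    let β := fun j => (∑ i, y i * stump (vL j) (vR j) i) / (((vL j ∪ vR j).card : ℝ))
    let yhat := fun i => ybar + ∑ j, β j * stump (vL j) (vR j) i
    ∀ (c0 : ℝ) (c : Fin m → ℝ),
      ∑ i, (y i - yhat i) ^ 2
        ≤ ∑ i, (y i - c0 - ∑ j, c j * stump (vL j) (vR j) i) ^ 2 := by
  intro ybar β yhat c0 c
  have hconst (j : Fin m) : ∑ i, stump (vL j) (vR j) i = 0 := by
    simpa using sum_mul_stump_eq_zero (f := fun _ => 1) (vL := vL j) (vR := vR j) 1 (by simp)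
  have key := sum_sq_sub_orthogonal_fit_le
    (fun (o : Option (Fin m)) i => o.elim 1 fun j => stump (vL j) (vR j) i)
    (by
      rintro (_ | j) (_ | k) hjk
      · exact absurd rfl hjk
      · simpa using hconst k
      · simpa using hconst j
      · exact sum_stump_mul_stump_eq_zero (hd j) (hd k) (laminar j k fun h => hjk (h ▸ rfl)))
    y (fun o => o.elim c0 c)
  simp only [Fintype.sum_option, Option.elim_none, Option.elim_some, mul_one, one_pow,
    Finset.sum_const, card_univ, Fintype.card_fin, nsmul_eq_mul,
    sum_stump_sq (hL _) (hR _) (hd _)] at key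
  simpa only [yhat, β, ybar, sub_sub, div_eq_inv_mul (∑ i, y i)] using key
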